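/- Let μ be the stationary Markov measure on {a,b}^ℕ with transition probabilities p_{aa} = p, p_{ab} = 1−p, p_{bb} = q, p_{ba} = 1−q, 0 < p,q < 1, and let f be the run-length encoder. For every even n ∈ ℕ, Σ_{C_n} (f_*μ)(C_n)² = (μ(a)² + μ(b)²)·((1−p)/(1+p))^{n/2}·((1−q)/(1+q))^{n/2}, where the sum is over all cylinders C_n of length n in B^ℕ. -/

import Mathlib

open MeasureTheory Filter Topology

section RLEDefs

variable {A : Type*}

/-- The starting position of the run following the run that starts at position `i`:
the least index `> i` where the value of `x` changes (with the junk convention `i + 1`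
if the sequence is constant from position `i` on). -/
noncomputable def nextChange (x : ℕ → A) (i : ℕ) : ℕ := by
  classical
  exact if h : ∃ j, x (i + j + 1) ≠ x i then i + Nat.find h + 1 else i + 1

/-- Starting position of the `n`-th maximal run of the sequence `x`. -/
noncomputable def runStart (x : ℕ → A) : ℕ → ℕ
  | 0 => 0
  | n + 1 => nextChange x (runStart x n)

/-- The run-length encoder `f : A^ℕ → (A × ℕ)^ℕ`: the `n`-th symbol of `f x` is the pair
(value of the `n`-th maximal run of `x`, length of that run). -/
noncomputable def rle (x : ℕ → A) (n : ℕ) : A × ℕ :=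
  (x (runStart x n), runStart x (n + 1) - runStart x n)

/-- `M_n(u,v)`: the length of the longest common substring of `u` and `v`
occurring within their first `n` symbols, i.e.
`max {k : u_i^{i+k-1} = v_j^{j+k-1} for some 0 ≤ i,j ≤ n-k}`. -/
noncomputable def matchLen {C : Type*} (u v : ℕ → C) (n : ℕ) : ℕ :=
  sSup {k | ∃ i j, i + k ≤ n ∧ j + k ≤ n ∧ ∀ m < k, u (i + m) = v (j + m)}

/-- `M^RLE_n(x,y) = M_n(f x, f y)`. -/
noncomputable def MRLE (x y : ℕ → A) (n : ℕ) : ℕ := matchLen (rle x) (rle y) n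

/-- `M̃_n(x,y) = max {k : f(σ^i x)_1^k = f(σ^j y)_1^k for some 0 ≤ i,j ≤ n-k}`. -/
noncomputable def Mtilde (x y : ℕ → A) (n : ℕ) : ℕ :=
  sSup {k | ∃ i j, i + k ≤ n ∧ j + k ≤ n ∧
    ∀ m < k, rle (fun t => x (t + i)) m = rle (fun t => y (t + j)) m}

/-- The number of maximal runs in the first `n` symbols of `x`, i.e. `|f(x_1^n)|`. -/
noncomputable def runCount (x : ℕ → A) (n : ℕ) : ℕ := by
  classical
  exact ((Finset.range n).filter fun i => i = 0 ∨ x i ≠ x (i - 1)).card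

/-- The left shift `σ` on sequences. -/
def shift (x : ℕ → A) : ℕ → A := fun n => x (n + 1)

variable [MeasurableSpace A]

/-- `Σ_{ω ∈ B^n} (f_*μ)(ω)²`: the sum, over all cylinders `ω` of length `n` in
`B^ℕ = (A × ℕ)^ℕ`, of the squared measure of `f⁻¹ω` (where `f` is the run-length
encoder), i.e. of the squared pushforward measure of the cylinder. -/
noncomputable def pushCylSum (μ : Measure (ℕ → A)) (n : ℕ) : ℝ :=
  ∑' ω : Fin n → A × ℕ, ((μ {x | ∀ i : Fin n, rle x i = ω i}).toReal) ^ 2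

/-- Lower Rényi entropy of order 2 of the pushforward measure `f_*μ`:
`H̲₂(f_*μ) = - liminf_n (1/n) log Σ_ω (f_*μ)(ω)²`. -/
noncomputable def H2lower (μ : Measure (ℕ → A)) : ℝ :=
  -liminf (fun n : ℕ => Real.log (pushCylSum μ n) / n) atTop

/-- Upper Rényi entropy of order 2 of the pushforward measure `f_*μ`:
`H̄₂(f_*μ) = - limsup_n (1/n) log Σ_ω (f_*μ)(ω)²`. -/
noncomputable def H2upper (μ : Measure (ℕ → A)) : ℝ :=
  -limsup (fun n : ℕ => Real.log (pushCylSum μ n) / n) atTop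

/-- Hypothesis (A): there are `c > 0`, `h > 0` with `μ(a…a) ≤ c e^{-hn}` for every
constant cylinder `a…a` of length `n`. -/
def HypA (μ : Measure (ℕ → A)) (c h : ℝ) : Prop :=
  0 < c ∧ 0 < h ∧
    ∀ (n : ℕ) (a : A), μ {x | ∀ i < n, x i = a} ≤ ENNReal.ofReal (c * Real.exp (-h * n))

/-- The σ-algebra `F_0^n` generated by the coordinates `X_0, …, X_n`. -/
def cylAlgLE (A : Type*) [MeasurableSpace A] (n : ℕ) : MeasurableSpace (ℕ → A) :=
  MeasurableSpace.comap (fun x (i : Fin (n + 1)) => x i) inferInstance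

/-- The σ-algebra `F_m^∞` generated by the coordinates `X_m, X_{m+1}, …`. -/
def cylAlgGE (A : Type*) [MeasurableSpace A] (m : ℕ) : MeasurableSpace (ℕ → A) :=
  MeasurableSpace.comap (fun x (i : ℕ) => x (m + i)) inferInstance

/-- α-mixing with rate function `a`: for all `n, g` and all `S ∈ F_0^n`, `T ∈ F_{n+g}^∞`,
`|μ(S ∩ T) - μ(S)μ(T)| ≤ a(g)`. -/
def AlphaMixingBound (μ : Measure (ℕ → A)) (a : ℕ → ℝ) : Prop :=
  ∀ (n g : ℕ) (S T : Set (ℕ → A)),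
    MeasurableSet[cylAlgLE A n] S → MeasurableSet[cylAlgGE A (n + g)] T →
    |(μ (S ∩ T)).toReal - (μ S).toReal * (μ T).toReal| ≤ a g

/-- α-mixing with exponential decay. -/
def AlphaMixingExp (μ : Measure (ℕ → A)) : Prop :=
  ∃ C θ : ℝ, 0 < C ∧ 0 < θ ∧ AlphaMixingBound μ fun g => C * Real.exp (-θ * g)

/-- ψ-mixing with polynomial rate `ψ(g) = g^{-a}`: for all `n` and `g ≥ 1` and all
`S ∈ F_0^n`, `T ∈ F_{n+g}^∞`, `|μ(S ∩ T) - μ(S)μ(T)| ≤ g^{-a} μ(S) μ(T)`. -/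
def PsiMixingPoly (μ : Measure (ℕ → A)) (a : ℝ) : Prop :=
  ∀ (n g : ℕ), 1 ≤ g → ∀ (S T : Set (ℕ → A)),
    MeasurableSet[cylAlgLE A n] S → MeasurableSet[cylAlgGE A (n + g)] T →
    |(μ (S ∩ T)).toReal - (μ S).toReal * (μ T).toReal| ≤
      (g : ℝ) ^ (-a) * (μ S).toReal * (μ T).toReal

/-- `S_n = Σ_{0 ≤ i,j ≤ n-1} 1_{A_{i,j}}` with `A_{i,j} = {f(σ^i X)_1^k = f(σ^j Y)_1^k}`,
seen as a random variable on the product space (X = first coordinate, Y = second). -/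
noncomputable def Sn (k n : ℕ) (p : (ℕ → A) × (ℕ → A)) : ℝ := by
  classical
  exact ∑ i ∈ Finset.range n, ∑ j ∈ Finset.range n,
    if ∀ m < k, rle (fun t => p.1 (t + i)) m = rle (fun t => p.2 (t + j)) m then (1 : ℝ) else 0

end RLEDefs

def altB (b : Bool) : ℕ → Bool
  | 0 => b
  | n + 1 => !(altB b n)

def sPos (k : ℕ → ℕ) (m : ℕ) : ℕ := ∑ i ∈ Finset.range m, (k i + 1)

theorem sPos_succ (k : ℕ → ℕ) (m : ℕ) : sPos k (m + 1) = sPos k m + (k m + 1) := by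
  simp [sPos, Finset.sum_range_succ]

theorem sPos_mono (k : ℕ → ℕ) : StrictMono (sPos k) :=
  strictMono_nat_of_lt_succ (fun m => by rw [sPos_succ]; omega)

def wSeq (b : Bool) (k : ℕ → ℕ) (i : ℕ) : Bool :=
  altB b (Nat.findGreatest (fun m => sPos k m ≤ i) i)

theorem wSeq_spec (b : Bool) (k : ℕ → ℕ) (m j : ℕ) (hj : j ≤ k m) :
    wSeq b k (sPos k m + j) = altB b m := by
  unfold wSeq
  congr 1
  rw [Nat.findGreatest_eq_iff]
  have h1 := (sPos_mono k).id_le m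
  simp only [id] at h1
  refine ⟨by omega, fun _ => by omega, fun t ht _ => ?_⟩
  have h2 : sPos k (m + 1) ≤ sPos k t := (sPos_mono k).monotone ht
  rw [sPos_succ] at h2
  omega

theorem nextChange_eq_iff {A : Type*} (x : ℕ → A) (i k : ℕ) (h : ∃ j, x (i + j + 1) ≠ x i) :
    nextChange x i = i + k + 1 ↔ (∀ j < k, x (i + j + 1) = x i) ∧ x (i + k + 1) ≠ x i := by
  classical
  have : nextChange x i = i + Nat.find h + 1 := by
    unfold nextChange
    rw [dif_pos h]
  rw [this]
  have : i + Nat.find h + 1 = i + k + 1 ↔ Nat.find h = k := by omega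
  rw [this, Nat.find_eq_iff]
  simp only [not_not]
  tauto

theorem nextChange_ex {A : Type*} (x : ℕ → A) (i : ℕ) (h : ∃ j, x (i + j + 1) ≠ x i) :
    ∃ k, nextChange x i = i + k + 1 := by
  classical
  refine ⟨Nat.find h, ?_⟩
  unfold nextChange
  rw [dif_pos h]

theorem bool_ne_iff' (a b : Bool) : a ≠ b ↔ a = !b := by cases a <;> cases b <;> simp

theorem altB_run (x : ℕ → Bool) (hx : ∀ i, ∃ j, x (i + j + 1) ≠ x i) (m : ℕ) :
    x (runStart x m) = altB (x 0) m := by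
  induction m with
  | zero => rfl
  | succ m ih =>
    obtain ⟨k, hk⟩ := nextChange_ex x (runStart x m) (hx _)
    have := ((nextChange_eq_iff x _ k (hx _)).1 hk).2
    rw [← hk, ih, bool_ne_iff'] at this
    exact this

theorem char_aux (x : ℕ → Bool) (hx : ∀ i, ∃ j, x (i + j + 1) ≠ x i) (b : Bool) (k : ℕ → ℕ)
    (m : ℕ) :
    ((x 0 = b ∧ ∀ i < m, rle x i = (altB b i, k i + 1)) ↔
      ∀ i ≤ sPos k m, x i = wSeq b k i) ∧
    ((∀ i ≤ sPos k m, x i = wSeq b k i) → runStart x m = sPos k m) := by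
  induction m with
  | zero =>
    have := wSeq_spec b k 0 0 (by omega)
    simp [sPos, altB] at this
    simp [sPos, runStart, this]
  | succ m ih =>
    obtain ⟨ih1, ih2⟩ := ih
    have hw := wSeq_spec b k m
    have hw0 := hw 0 (by omega)
    have hw' := wSeq_spec b k (m + 1) 0 (by omega)
    have hs := sPos_succ k m
    have key : (∀ i ≤ sPos k (m + 1), x i = wSeq b k i) ↔
        (∀ i ≤ sPos k m, x i = wSeq b k i) ∧ nextChange x (sPos k m) = sPos k m + k m + 1 := by
      rw [nextChange_eq_iff x _ _ (hx _), bool_ne_iff']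
      constructor
      · intro h
        have h0 : x (sPos k m) = altB b m := by
          rw [h _ (by omega)]; simpa using hw0
        refine ⟨fun i hi => h i (by omega), fun j hj => ?_, ?_⟩
        · rw [h _ (by omega), add_assoc, hw (j + 1) (by omega), h0]
        · rw [h0, h _ (by omega), add_assoc, ← hs]
          simpa [altB] using hw'
      · rintro ⟨h, h1, h2⟩ i hi
        have h0 : x (sPos k m) = altB b m := by
          rw [h _ le_rfl]; simpa using hw0
        rcases Nat.lt_or_ge (sPos k m) i with hlt | hge
        · obtain ⟨j, rfl⟩ := Nat.exists_eq_add_of_lt hlt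
          rcases Nat.lt_or_ge j (k m) with hj | hj
          · rw [h1 j hj, h0, add_assoc, hw (j + 1) (by omega)]
          · have : j = k m := by omega
            subst this
            rw [h2, h0, add_assoc, ← hs]
            rw [add_zero] at hw'
            rw [hw']
            rfl
        · exact h i hge
    have hr : (∀ i ≤ sPos k m, x i = wSeq b k i) →
        (rle x m = (altB b m, k m + 1) ↔ nextChange x (sPos k m) = sPos k m + k m + 1) := by
      intro h
      have h0 : x (sPos k m) = altB b m := by
        rw [h _ le_rfl]; simpa using hw0
      simp only [rle, runStart, ih2 h, h0, Prod.mk.injEq, true_and]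
      omega
    constructor
    · rw [key, ← ih1]
      constructor
      · rintro ⟨h0, h⟩
        have hm : x 0 = b ∧ ∀ i < m, rle x i = (altB b i, k i + 1) :=
          ⟨h0, fun i hi => h i (by omega)⟩
        exact ⟨hm, (hr (ih1.1 hm)).1 (h m (by omega))⟩
      · rintro ⟨hm, h⟩
        refine ⟨hm.1, fun i hi => ?_⟩
        rcases Nat.lt_or_ge i m with h' | h'
        · exact hm.2 i h'
        · have : i = m := by omega
          subst this
          exact (hr (ih1.1 hm)).2 h
    · intro h
      obtain ⟨h1, h2⟩ := key.1 h
      simp only [runStart, ih2 h1, h2, hs]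
      omega

noncomputable def trB (p q : ℝ) (a b : Bool) : ℝ :=
  if a then (if b then p else 1 - p) else (if b then 1 - q else q)

noncomputable def inB (p q : ℝ) (a : Bool) : ℝ :=
  if a then (1 - q) / (2 - p - q) else (1 - p) / (2 - p - q)

noncomputable def rB (p q : ℝ) (a : Bool) : ℝ := if a then p else q

theorem prod_w (p q : ℝ) (b : Bool) (k : ℕ → ℕ) (m : ℕ) :
    ∏ i ∈ Finset.range (sPos k m), trB p q (wSeq b k i) (wSeq b k (i + 1)) =
      ∏ i ∈ Finset.range m, (rB p q (altB b i) ^ (k i) * (1 - rB p q (altB b i))) := by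
  induction m with
  | zero => simp [sPos]
  | succ m ih =>
    have hw' := wSeq_spec b k (m + 1) 0 (by omega)
    rw [sPos_succ, Finset.prod_range_add, ih, Finset.prod_range_succ _ m]
    congr 1
    rw [Finset.prod_range_succ]
    congr 1
    · rw [Finset.prod_congr rfl (g := fun _ => rB p q (altB b m))]
      · simp
      · intro j hj
        have hj := Finset.mem_range.1 hj
        rw [add_assoc, wSeq_spec b k m j (by omega), wSeq_spec b k m (j + 1) (by omega)]
        cases altB b m <;> simp [trB, rB]
    · rw [wSeq_spec b k m (k m) le_rfl, add_assoc, ← sPos_succ]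
      rw [add_zero] at hw'
      rw [hw']
      simp only [altB]
      cases altB b m <;> simp [trB, rB]

theorem hasSum_mul_nn {ι κ : Type*} (f : ι → ℝ) (g : κ → ℝ) (a b : ℝ) (hf : HasSum f a)
    (hg : HasSum g b) (h1 : ∀ i, 0 ≤ f i) (h2 : ∀ i, 0 ≤ g i) :
    HasSum (fun x : ι × κ => f x.1 * g x.2) (a * b) :=
  HasSum.mul hf hg (Summable.mul_of_nonneg hf.summable hg.summable h1 h2)

theorem hasSum_pi_prod (n : ℕ) (f : Fin n → ℕ → ℝ) (a : Fin n → ℝ) (hf0 : ∀ i j, 0 ≤ f i j)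
    (hf : ∀ i, HasSum (f i) (a i)) :
    HasSum (fun k : Fin n → ℕ => ∏ i, f i (k i)) (∏ i, a i) := by
  induction n with
  | zero => simp
  | succ n ih =>
    have h1 : HasSum (fun k : Fin n → ℕ => ∏ i : Fin n, f i.succ (k i)) (∏ i : Fin n, a i.succ) :=
      ih (fun i : Fin n => f i.succ) (fun i : Fin n => a i.succ) (fun i => hf0 i.succ)
        (fun i => hf i.succ)
    have p2 : ∀ k : Fin n → ℕ, 0 ≤ ∏ i : Fin n, f i.succ (k i) :=
      fun k => Finset.prod_nonneg (fun i _ => hf0 i.succ (k i))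
    have h2 := hasSum_mul_nn (f 0) _ _ _ (hf 0) h1 (hf0 0) p2
    rw [Fin.prod_univ_succ, ← (Fin.consEquiv (fun _ => ℕ)).hasSum_iff]
    have e : ((fun k : Fin (n + 1) → ℕ => ∏ i, f i (k i)) ∘ (Fin.consEquiv (fun _ => ℕ))) =
        (fun x : ℕ × (Fin n → ℕ) => f 0 x.1 * ∏ i, f i.succ (x.2 i)) := by
      funext x
      simp [Fin.consEquiv, Fin.prod_univ_succ]
    rw [e]
    exact h2

theorem hasSum_geo (r : ℝ) (h0 : 0 < r) (h1 : r < 1) :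
    HasSum (fun j : ℕ => (r ^ j * (1 - r)) ^ 2) ((1 - r) / (1 + r)) := by
  have h := (hasSum_geometric_of_lt_one (r := r ^ 2) (by positivity) (by nlinarith)).mul_right
    ((1 - r) ^ 2)
  have e1 : (fun j : ℕ => (r ^ j * (1 - r)) ^ 2) = fun j : ℕ => (r ^ 2) ^ j * (1 - r) ^ 2 := by
    funext j
    ring
  have e2 : (1 - r) / (1 + r) = (1 - r ^ 2)⁻¹ * (1 - r) ^ 2 := by
    have : 1 - r ^ 2 = (1 - r) * (1 + r) := by ring
    rw [this]
    have : 1 - r ≠ 0 := by linarith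
    have : 1 + r ≠ 0 := by linarith
    field_simp
  rw [e1, e2]
  exact h

theorem prod_alt (g : Bool → ℝ) (b : Bool) (t : ℕ) :
    ∏ i ∈ Finset.range (t + t), g (altB b i) = g true ^ t * g false ^ t := by
  have halt : ∀ t, altB b (t + t) = b := by
    intro t
    induction t with
    | zero => rfl
    | succ t ih =>
      have : t + 1 + (t + 1) = t + t + 1 + 1 := by omega
      rw [this]; simp [altB, ih]
  induction t with
  | zero => simp
  | succ t ih =>
    have : t + 1 + (t + 1) = t + t + 1 + 1 := by omega
    rw [this, Finset.prod_range_succ, Finset.prod_range_succ, ih]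
    simp only [altB, halt]
    cases b <;> simp <;> ring

theorem cyl_meas (p q : ℝ) (μ : Measure (ℕ → Bool))
    (hμ : ∀ (n : ℕ) (w : Fin (n + 1) → Bool),
      μ {x | ∀ i : Fin (n + 1), x i = w i} =
        ENNReal.ofReal
          ((if w 0 then (1 - q) / (2 - p - q) else (1 - p) / (2 - p - q)) *
            ∏ i : Fin n,
              if w i.castSucc then (if w i.succ then p else 1 - p)
              else (if w i.succ then 1 - q else q)))
    (w : ℕ → Bool) (N : ℕ) :
    μ {x | ∀ i ≤ N, x i = w i} =
      ENNReal.ofReal (inB p q (w 0) * ∏ i ∈ Finset.range N, trB p q (w i) (w (i + 1))) := by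
  have h := hμ N (fun i => w i)
  have e : {x : ℕ → Bool | ∀ i ≤ N, x i = w i} =
      {x | ∀ i : Fin (N + 1), x i = w i} := by
    ext x
    simp only [Set.mem_ofPred_eq]
    exact ⟨fun h i => h i (by omega), fun h i hi => h ⟨i, by omega⟩⟩
  rw [e, h]
  rw [Finset.prod_range]
  rfl

theorem null_single (p q : ℝ) (hp0 : 0 < p) (hp1 : p < 1) (hq0 : 0 < q) (hq1 : q < 1)
    (μ : Measure (ℕ → Bool))
    (h : ∀ (w : ℕ → Bool) (N : ℕ), μ {x | ∀ i ≤ N, x i = w i} =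
      ENNReal.ofReal (inB p q (w 0) * ∏ i ∈ Finset.range N, trB p q (w i) (w (i + 1))))
    (w : ℕ → Bool) : μ {w} = 0 := by
  obtain ⟨r, hr0, hr1, hr⟩ : ∃ r : ℝ, 0 ≤ r ∧ r < 1 ∧ ∀ a b, trB p q a b ≤ r := by
    refine ⟨max (max p (1 - p)) (max q (1 - q)), ?_, ?_, ?_⟩
    · exact le_max_of_le_left (le_max_of_le_left hp0.le)
    · simp only [max_lt_iff]; refine ⟨⟨?_, ?_⟩, ?_, ?_⟩ <;> linarith
    · intro a b
      cases a <;> cases b <;> simp [trB]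
  have tr0 : ∀ a b, 0 ≤ trB p q a b := by
    intro a b
    cases a <;> cases b <;> simp [trB] <;> linarith
  have in0 : 0 ≤ inB p q (w 0) := by
    unfold inB
    split_ifs <;> apply div_nonneg <;> linarith
  have hb : ∀ N, μ {w} ≤ ENNReal.ofReal (inB p q (w 0) * r ^ N) := by
    intro N
    refine (measure_mono (t := {x | ∀ i ≤ N, x i = w i}) ?_).trans ?_
    · rintro x rfl i _; rfl
    · rw [h]
      apply ENNReal.ofReal_le_ofReal
      apply mul_le_mul_of_nonneg_left _ in0
      calc _ ≤ ∏ i ∈ Finset.range N, r :=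
            Finset.prod_le_prod (fun _ _ => tr0 _ _) (fun _ _ => hr _ _)
        _ = r ^ N := by simp
  have ht : Tendsto (fun N : ℕ => ENNReal.ofReal (inB p q (w 0) * r ^ N)) atTop (𝓝 0) := by
    have := ENNReal.tendsto_ofReal
      ((tendsto_pow_atTop_nhds_zero_of_lt_one hr0 hr1).const_mul (inB p q (w 0)))
    simpa using this
  exact le_antisymm (ge_of_tendsto' ht hb) (zero_le)

theorem ae_change (μ : Measure (ℕ → Bool)) (h : ∀ w, μ {w} = 0) :
    ∀ᵐ x ∂μ, ∀ i, ∃ j, x (i + j + 1) ≠ x i := by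
  rw [ae_iff]
  refine measure_mono_null (t := ⋃ s : Σ i : ℕ, (Fin (i + 1) → Bool),
    {fun n => s.2 ⟨min n s.1, by omega⟩}) ?_ ?_
  · intro x hx
    simp only [Set.mem_ofPred_eq, not_forall, not_exists, not_not] at hx
    obtain ⟨i, hi⟩ := hx
    simp only [Set.mem_iUnion, Set.mem_singleton_iff]
    refine ⟨⟨i, fun t => x t⟩, ?_⟩
    ext n
    simp only
    rcases Nat.lt_or_ge i n with hlt | hge
    · obtain ⟨j, rfl⟩ := Nat.exists_eq_add_of_lt hlt
      rw [hi, min_eq_right (by omega)]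
    · rw [min_eq_left hge]
  · exact measure_iUnion_null (fun s => h _)

def phiB (n : ℕ) (s : Bool × (Fin n → ℕ)) : Fin n → Bool × ℕ :=
  fun i => (altB s.1 i, s.2 i + 1)

theorem phiB_inj (n : ℕ) (hn0 : 0 < n) : Function.Injective (phiB n) := by
  rintro ⟨b, k⟩ ⟨b', k'⟩ h
  have h1 : ∀ i, phiB n (b, k) i = phiB n (b', k') i := fun i => by rw [h]
  simp only [phiB, Prod.mk.injEq] at h1
  have h2 := (h1 ⟨0, hn0⟩).1
  simp only [altB] at h2
  ext i
  · simp [h2]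
  · have := (h1 i).2
    simpa using this

theorem stmt14_aux (p q : ℝ) (hp0 : 0 < p) (hp1 : p < 1) (hq0 : 0 < q) (hq1 : q < 1)
    (μ : Measure (ℕ → Bool))
    (h : ∀ (w : ℕ → Bool) (N : ℕ), μ {x | ∀ i ≤ N, x i = w i} =
      ENNReal.ofReal (inB p q (w 0) * ∏ i ∈ Finset.range N, trB p q (w i) (w (i + 1))))
    (n : ℕ) (hn : Even n) (hn0 : 0 < n) :
    pushCylSum μ n =
      (((1 - q) / (2 - p - q)) ^ 2 + ((1 - p) / (2 - p - q)) ^ 2) *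
        ((1 - p) / (1 + p)) ^ (n / 2) * ((1 - q) / (1 + q)) ^ (n / 2) := by
  have hae := ae_change μ (null_single p q hp0 hp1 hq0 hq1 μ h)
  have r0 : ∀ b, 0 < rB p q b := by intro b; cases b <;> simp [rB, *]
  have r1 : ∀ b, rB p q b < 1 := by intro b; cases b <;> simp [rB, *]
  have in0 : ∀ b, 0 ≤ inB p q b := by
    intro b
    unfold inB
    split_ifs <;> apply div_nonneg <;> linarith
  have hval : ∀ s : Bool × (Fin n → ℕ),
      ((μ {x | ∀ i : Fin n, rle x i = phiB n s i}).toReal) ^ 2 =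
      (inB p q s.1) ^ 2 *
        ∏ i : Fin n, (rB p q (altB s.1 i) ^ (s.2 i) * (1 - rB p q (altB s.1 i))) ^ 2 := by
    rintro ⟨b, k⟩
    let k' : ℕ → ℕ := fun i => if hi : i < n then k ⟨i, hi⟩ else 0
    have hk' : ∀ i : Fin n, k' i = k i := fun i => by simp [k']
    have e : μ {x | ∀ i : Fin n, rle x i = phiB n (b, k) i} =
        μ {x | ∀ i ≤ sPos k' n, x i = wSeq b k' i} := by
      apply measure_congr
      filter_upwards [hae] with x hx
      apply propext
      change (∀ i : Fin n, rle x i = phiB n (b, k) i) ↔ ∀ i ≤ sPos k' n, x i = wSeq b k' i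
      rw [← (char_aux x hx b k' n).1]
      constructor
      · intro h
        refine ⟨?_, fun i hi => ?_⟩
        · have := congrArg Prod.fst (h ⟨0, hn0⟩)
          simpa [rle, runStart, phiB, altB] using this
        · have := h ⟨i, hi⟩
          have h3 := hk' ⟨i, hi⟩
          simp only at h3 this
          rw [this, h3]
          rfl
      · rintro ⟨_, h⟩ i
        rw [h i i.2, hk']
        rfl
    have hw0 : wSeq b k' 0 = b := by
      have := wSeq_spec b k' 0 0 (by omega)
      simpa [sPos, altB] using this
    rw [e, h, prod_w, hw0, ENNReal.toReal_ofReal, mul_pow, Finset.prod_range, Finset.prod_pow]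
    · simp only [hk']
    · refine mul_nonneg (in0 _) (Finset.prod_nonneg fun i _ => mul_nonneg (pow_nonneg (r0 _).le _) ?_)
      linarith [r1 (altB b i)]
  have hsupp : Function.support (fun ω : Fin n → Bool × ℕ =>
      ((μ {x | ∀ i : Fin n, rle x i = ω i}).toReal) ^ 2) ⊆ Set.range (phiB n) := by
    intro ω hω
    by_contra hcon
    apply hω
    have : μ {x | ∀ i : Fin n, rle x i = ω i} = 0 := by
      rw [measure_eq_zero_iff_ae_notMem]
      filter_upwards [hae] with x hx hmem
      apply hcon
      refine ⟨(x 0, fun i => (ω i).2 - 1), ?_⟩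
      funext i
      have hi : rle x i = ω i := hmem i
      have hpos : 0 < (rle x i).2 := by
        obtain ⟨k, hk⟩ := nextChange_ex x (runStart x i) (hx _)
        simp only [rle, runStart, hk]
        omega
      have h1 : (rle x i).1 = altB (x 0) i := altB_run x hx i
      rw [hi] at hpos h1
      simp only [phiB]
      ext
      · simp [h1]
      · simp only; omega
    simp [this]
  unfold pushCylSum
  rw [← (phiB_inj n hn0).tsum_eq hsupp]
  simp only [hval]
  obtain ⟨t, rfl⟩ := hn
  have hS : ∀ b : Bool, HasSum (fun k : Fin (t + t) → ℕ => (inB p q b) ^ 2 *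
        ∏ i : Fin (t + t), (rB p q (altB b i) ^ (k i) * (1 - rB p q (altB b i))) ^ 2)
      ((inB p q b) ^ 2 * (((1 - p) / (1 + p)) ^ t * ((1 - q) / (1 + q)) ^ t)) := by
    intro b
    have h1 := hasSum_pi_prod (t + t)
      (fun i j => (rB p q (altB b i) ^ j * (1 - rB p q (altB b i))) ^ 2)
      (fun i => (1 - rB p q (altB b i)) / (1 + rB p q (altB b i)))
      (fun _ _ => sq_nonneg _) (fun i => hasSum_geo _ (r0 _) (r1 _))
    have h2 := prod_alt (fun b => (1 - rB p q b) / (1 + rB p q b)) b t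
    rw [Finset.prod_range] at h2
    rw [h2] at h1
    simpa [rB] using h1.mul_left ((inB p q b) ^ 2)
  have hsum : Summable (fun s : Bool × (Fin (t + t) → ℕ) => (inB p q s.1) ^ 2 *
        ∏ i : Fin (t + t), (rB p q (altB s.1 i) ^ (s.2 i) * (1 - rB p q (altB s.1 i))) ^ 2) := by
    rw [summable_prod_of_nonneg]
    · exact ⟨fun b => (hS b).summable, (hasSum_fintype _).summable⟩
    · intro s
      exact mul_nonneg (sq_nonneg _) (Finset.prod_nonneg fun _ _ => sq_nonneg _)
  rw [hsum.tsum_prod' (fun b => (hS b).summable), tsum_fintype]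
  simp only [(hS _).tsum_eq]
  have : (t + t) / 2 = t := by omega
  rw [this]
  simp [inB]
  ring

/-- Example `exmark1`: for the stationary two-state Markov measure on
`{a,b}^ℕ` (`a = true`, `b = false`, `p_{aa} = p`, `p_{bb} = q`, `0 < p,q < 1`,
stationary probabilities `μ(a) = (1-q)/(2-p-q)`, `μ(b) = (1-p)/(2-p-q)`), for every
even `n ≥ 1`,
`Σ_{C_n}(f_*μ)(C_n)² = (μ(a)² + μ(b)²) ((1-p)/(1+p))^{n/2} ((1-q)/(1+q))^{n/2}`. -/
theorem stmt14 (p q : ℝ) (hp0 : 0 < p) (hp1 : p < 1) (hq0 : 0 < q) (hq1 : q < 1)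
    (μ : Measure (ℕ → Bool)) [IsProbabilityMeasure μ]
    (hμ : ∀ (n : ℕ) (w : Fin (n + 1) → Bool),
      μ {x | ∀ i : Fin (n + 1), x i = w i} =
        ENNReal.ofReal
          ((if w 0 then (1 - q) / (2 - p - q) else (1 - p) / (2 - p - q)) *
            ∏ i : Fin n,
              if w i.castSucc then (if w i.succ then p else 1 - p)
              else (if w i.succ then 1 - q else q)))
    (n : ℕ) (hn : Even n) (hn0 : 0 < n) :
    pushCylSum μ n =
      (((1 - q) / (2 - p - q)) ^ 2 + ((1 - p) / (2 - p - q)) ^ 2) *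
        ((1 - p) / (1 + p)) ^ (n / 2) * ((1 - q) / (1 + q)) ^ (n / 2) := by
  exact stmt14_aux p q hp0 hp1 hq0 hq1 μ (cyl_meas p q μ hμ) n hn hn0
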